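/- Let n ≥ 1. Summing over all sequences of partitions ∅ = λ^{(0)} ≺ λ^{(1)} ≺ ⋯ ≺ λ^{(n)} = μ^{(n)} ≻ μ^{(n−1)} ≻ ⋯ ≻ μ^{(1)} ≻ μ^{(0)} = ∅ (i.e. over plane partitions with base contained in an n×n square, recorded by their diagonal slices), one has Σ ∏_{i=1}^{n} (1 − t^{λ^{(n)}_i − i + n + 1}) · ∏_{i=1}^{n} x_i^{|λ^{(i)}|−|λ^{(i−1)}|} y_i^{|μ^{(i)}|−|μ^{(i−1)}|} = (Δ(x)_n Δ(y)_n)^{-1} · det[ (1−t) / ((1−x_i y_j)(1−t x_i y_j)) ]_{1≤i,j≤n}. -/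

import Mathlib

noncomputable section

open scoped BigOperators

/-- The Vandermonde product `Δ(x)ₙ = ∏_{i<j} (x i - x j)`. -/
def vprod {n : ℕ} (x : Fin n → ℂ) : ℂ :=
  ∏ i : Fin n, ∏ j ∈ Finset.Ioi i, (x i - x j)

/-- `Interlace a b` means `a ≻ b`, i.e. `a₁ ≥ b₁ ≥ a₂ ≥ b₂ ≥ ⋯`. -/
def Interlace {m : ℕ} (a b : Fin m → ℕ) : Prop :=
  (∀ i, b i ≤ a i) ∧ ∀ i : ℕ, ∀ h : i + 1 < m, a ⟨i + 1, h⟩ ≤ b ⟨i, by omega⟩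

/-- The weight `|λ| = Σᵢ λᵢ` of a partition. -/
def wt {m : ℕ} (l : Fin m → ℕ) : ℕ := ∑ i, l i

/-- The determinant of a matrix with columns given by finite sums is the sum of the determinants. -/
lemma det_of_sum_col {n : ℕ} (s : Fin n → Finset ℕ) (f : Fin n → ℕ → Fin n → ℂ) :
    (Matrix.of fun i j => ∑ m ∈ s j, f j m i).det =
      ∑ μ ∈ Fintype.piFinset s, (Matrix.of fun i j => f j (μ j) i).det := by
  simp only [Matrix.det_apply', Matrix.of_apply, Finset.prod_univ_sum, Finset.mul_sum]
  exact Finset.sum_comm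

/-- Subtracting from each column a multiple of its right neighbour does not change the
determinant. -/
lemma det_eq_of_forall_col_eq_smul_add_succ {n : ℕ}
    {A B : Matrix (Fin (n + 1)) (Fin (n + 1)) ℂ} (c : Fin n → ℂ)
    (hlast : ∀ i, A i (Fin.last n) = B i (Fin.last n))
    (hcast : ∀ i (j : Fin n), A i j.castSucc = B i j.castSucc + c j * A i j.succ) :
    A.det = B.det := by
  rw [← Matrix.det_submatrix_equiv_self Fin.revPerm A,
    ← Matrix.det_submatrix_equiv_self Fin.revPerm B]
  refine Matrix.det_eq_of_forall_col_eq_smul_add_pred (fun j => c j.rev) (fun i => ?_)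
    (fun i j => ?_)
  · simpa using hlast _
  · simpa [Fin.rev_succ, Fin.rev_castSucc] using hcast i.rev j.rev

/-- A determinant whose last row vanishes off the corner. -/
lemma det_of_last_row_eq_zero {n : ℕ} (A : Matrix (Fin (n + 1)) (Fin (n + 1)) ℂ)
    (h : ∀ j : Fin n, A (Fin.last n) j.castSucc = 0) :
    A.det = A (Fin.last n) (Fin.last n) *
      (Matrix.of fun i j : Fin n => A i.castSucc j.castSucc).det := by
  rw [Matrix.det_succ_row A (Fin.last n), Fin.sum_univ_castSucc]
  simp only [h, Fin.val_last, Fin.succAbove_last]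
  rw [Even.neg_one_pow ⟨n, rfl⟩]
  simp only [mul_zero, zero_mul, Finset.sum_const_zero, zero_add, one_mul]
  rfl

lemma vprod_succ {n : ℕ} (x : Fin (n + 1) → ℂ) :
    vprod x = vprod (fun i : Fin n => x i.castSucc) *
      ∏ i : Fin n, (x i.castSucc - x (Fin.last n)) := by
  have key : ∀ {m : ℕ} (z : Fin m → ℂ),
      vprod z = ∏ i, ∏ j, if i < j then z i - z j else 1 := by
    intro m z
    unfold vprod
    refine Finset.prod_congr rfl fun i _ => ?_
    rw [← Finset.prod_filter]
    congr 1
    ext j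
    simp
  rw [key, key, Fin.prod_univ_castSucc]
  simp [Fin.prod_univ_castSucc, Finset.prod_mul_distrib, Fin.castSucc_lt_last,
    (Fin.castSucc_lt_last _).not_gt]

lemma sub_mul_sum_Icc_pow (u z : ℂ) (a b d : ℕ) (h : b ≤ a) :
    (u - z) * ∑ m ∈ Finset.Icc b a, u ^ (m + d) * z ^ (a - m) =
      u ^ (a + d + 1) - z ^ (a - b + 1) * u ^ (b + d) := by
  obtain ⟨c, rfl⟩ := Nat.exists_eq_add_of_le h
  have : ∑ m ∈ Finset.Icc b (b + c), u ^ (m + d) * z ^ (b + c - m) =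
      u ^ (b + d) * ∑ i ∈ Finset.range (c + 1), u ^ i * z ^ (c + 1 - 1 - i) := by
    rw [← Finset.Ico_add_one_right_eq_Icc, Finset.sum_Ico_eq_sum_range, Finset.mul_sum]
    rw [show b + c + 1 - b = c + 1 by omega]
    refine Finset.sum_congr rfl fun i hi => ?_
    rw [show b + c - (b + i) = c + 1 - 1 - i by omega]
    ring
  rw [this, mul_left_comm, mul_comm (u - z), geom_sum₂_mul, show b + c - b + 1 = c + 1 by omega]
  ring

/-- The alternant `det (x i ^ (λ j + k - 1 - j))`. -/
def alternant {k : ℕ} (x : Fin k → ℂ) (l : Fin k → ℕ) : ℂ :=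
  (Matrix.of fun i j : Fin k => x i ^ (l j + (k - 1 - (j : ℕ)))).det

/-- The set of `μ` interlacing with a partition `λ` that has one more part. -/
def below {k : ℕ} (l : Fin (k + 1) → ℕ) : Finset (Fin k → ℕ) :=
  Fintype.piFinset fun j => Finset.Icc (l j.succ) (l j.castSucc)

/-- Branching rule for alternants. -/
lemma alternant_succ {k : ℕ} (x : Fin (k + 1) → ℂ) (l : Fin (k + 1) → ℕ) (hl : Antitone l) :
    alternant x l = (∏ i : Fin k, (x i.castSucc - x (Fin.last k))) *
      ∑ μ ∈ below l, x (Fin.last k) ^ (∑ j, l j - ∑ j, μ j) *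
        alternant (fun i : Fin k => x i.castSucc) μ := by
  set z := x (Fin.last k) with hz
  have hdesc : ∀ j : Fin k, l j.succ ≤ l j.castSucc := fun j => hl (Fin.castSucc_le_succ j)
  set B : Matrix (Fin (k + 1)) (Fin (k + 1)) ℂ := Matrix.of fun i j =>
    Fin.lastCases (motive := fun _ => ℂ) (x i ^ l (Fin.last k))
      (fun j : Fin k => (x i - z) * ∑ m ∈ Finset.Icc (l j.succ) (l j.castSucc),
        x i ^ (m + (k - 1 - (j : ℕ))) * z ^ (l j.castSucc - m)) j with hB
  have h1 : alternant x l = B.det := by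
    refine det_eq_of_forall_col_eq_smul_add_succ
      (fun j => z ^ (l j.castSucc - l j.succ + 1)) (fun i => ?_) (fun i j => ?_)
    · simp [hB]
    · simp only [hB, Matrix.of_apply, Fin.lastCases_castSucc]
      rw [sub_mul_sum_Icc_pow _ _ _ _ _ (hdesc j)]
      have hj := j.2
      simp only [Fin.val_castSucc, Fin.val_succ]
      rw [show l j.castSucc + (k + 1 - 1 - (j : ℕ)) = l j.castSucc + (k - 1 - (j : ℕ)) + 1 by omega,
        show l j.succ + (k + 1 - 1 - ((j : ℕ) + 1)) = l j.succ + (k - 1 - (j : ℕ)) by omega]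
      ring
  rw [h1, det_of_last_row_eq_zero B (fun j => by simp [hB, hz])]
  have h2 : (Matrix.of fun i j : Fin k => B i.castSucc j.castSucc) =
      Matrix.of fun i j : Fin k => (x i.castSucc - z) *
        (Matrix.of fun i j : Fin k => ∑ m ∈ Finset.Icc (l j.succ) (l j.castSucc),
          x i.castSucc ^ (m + (k - 1 - (j : ℕ))) * z ^ (l j.castSucc - m)) i j := by
    ext i j
    simp [hB]
  rw [h2, Matrix.det_mul_column, det_of_sum_col _
    (fun j m i => x i.castSucc ^ (m + (k - 1 - (j : ℕ))) * z ^ (l j.castSucc - m)),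
    mul_left_comm, Finset.mul_sum]
  congr 1
  refine Finset.sum_congr rfl fun μ hμ => ?_
  have hμ' : ∀ j, l j.succ ≤ μ j ∧ μ j ≤ l j.castSucc := fun j => by
    simpa using Fintype.mem_piFinset.1 hμ j
  have h3 : (Matrix.of fun i j : Fin k =>
      x i.castSucc ^ (μ j + (k - 1 - (j : ℕ))) * z ^ (l j.castSucc - μ j)).det =
      (∏ j, z ^ (l j.castSucc - μ j)) * alternant (fun i : Fin k => x i.castSucc) μ := by
    rw [alternant, ← Matrix.det_mul_row]
    congr 1
    ext i j
    simp [mul_comm]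
  rw [h3, ← mul_assoc, Finset.prod_pow_eq_pow_sum]
  congr 1
  simp only [hB, Matrix.of_apply, Fin.lastCases_last, ← hz]
  rw [← pow_add, Finset.sum_tsub_distrib _ (fun j _ => (hμ' j).2), Fin.sum_univ_castSucc]
  have : ∑ j, μ j ≤ ∑ j : Fin k, l j.castSucc := Finset.sum_le_sum fun j _ => (hμ' j).2
  congr 1
  omega

/-- Extension of a finite sequence by zero (or its truncation) to length `N`. -/
def extendZero (N : ℕ) {k : ℕ} (l : Fin k → ℕ) : Fin N → ℕ :=
  fun i => if h : (i : ℕ) < k then l ⟨i, h⟩ else 0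

lemma extendZero_self {n : ℕ} (l : Fin n → ℕ) : extendZero n l = l := by
  ext i
  simp [extendZero]

lemma extendZero_injective {N k : ℕ} (hk : k ≤ N) :
    Function.Injective (extendZero N : (Fin k → ℕ) → Fin N → ℕ) := by
  intro a b h
  ext i
  simpa [extendZero] using congrFun h (Fin.castLE hk i)

lemma wt_extendZero {N k : ℕ} (hk : k ≤ N) (l : Fin k → ℕ) :
    wt (extendZero N l) = ∑ i, l i := by
  obtain ⟨d, rfl⟩ := Nat.exists_eq_add_of_le hk
  simp [wt, Fin.sum_univ_add, extendZero]

lemma interlace_extendZero_iff {N k : ℕ} (hk : k + 1 ≤ N) (l : Fin (k + 1) → ℕ)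
    (μ : Fin k → ℕ) :
    Interlace (extendZero N l) (extendZero N μ) ↔ μ ∈ below l := by
  simp only [below, Fintype.mem_piFinset, Finset.mem_Icc]
  constructor
  · rintro ⟨h1, h2⟩ j
    have hj := j.2
    have a := h1 ⟨j, by omega⟩
    have b := h2 j (by omega)
    simp only [extendZero, hj, show (j : ℕ) < k + 1 by omega, show (j : ℕ) + 1 < k + 1 by omega,
      dif_pos] at a b
    exact ⟨b, a⟩
  · intro h
    refine ⟨fun i => ?_, fun i hi => ?_⟩
    · by_cases hik : (i : ℕ) < k
      · simpa [extendZero, hik, show (i : ℕ) < k + 1 by omega] using (h ⟨i, hik⟩).2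
      · simp [extendZero, hik]
    · by_cases hik : i < k
      · simpa [extendZero, hik] using (h ⟨i, hik⟩).1
      · simp [extendZero, hik]

/-- The finite set of interlacing sequences `∅ = λ⁽⁰⁾ ≺ ⋯ ≺ λ⁽ᵏ⁾ = λ`, all padded to length `N`. -/
def chains (N : ℕ) : (k : ℕ) → (Fin k → ℕ) → Finset (Fin (k + 1) → Fin N → ℕ)
  | 0, _ => {fun _ _ => 0}
  | k + 1, l => (below l).biUnion fun μ =>
      (chains N k μ).image fun p => Fin.snoc p (extendZero N l)

lemma apply_eq_zero_of_interlace {N k : ℕ} {p : Fin (k + 1) → Fin N → ℕ} (h0 : p 0 = fun _ => 0)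
    (h : ∀ j : Fin k, Interlace (p j.succ) (p j.castSucc)) (j : Fin (k + 1)) :
    ∀ i : Fin N, (j : ℕ) ≤ i → p j i = 0 := by
  induction j using Fin.induction with
  | zero => simp [h0]
  | succ j ih =>
    rintro ⟨i, hi⟩ hij
    obtain _ | i := i
    · simp at hij
    · have h1 := (h j).2 i hi
      rw [ih ⟨i, by omega⟩ (by simpa using hij)] at h1
      omega

lemma mem_chains_iff {N : ℕ} : ∀ {k : ℕ} (_ : k ≤ N) (l : Fin k → ℕ)
    (p : Fin (k + 1) → Fin N → ℕ), p ∈ chains N k l ↔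
      p 0 = (fun _ => 0) ∧ p (Fin.last k) = extendZero N l ∧
        ∀ j : Fin k, Interlace (p j.succ) (p j.castSucc)
  | 0, _, l, p => by
    simp only [chains, Finset.mem_singleton]
    constructor
    · rintro rfl
      exact ⟨rfl, by ext i; simp [extendZero], fun j => j.elim0⟩
    · rintro ⟨h, -⟩
      ext j : 1
      rw [Fin.fin_one_eq_zero j, h]
  | k + 1, hk, l, p => by
    simp only [chains, Finset.mem_biUnion, Finset.mem_image]
    constructor
    · rintro ⟨μ, hμ, q, hq, rfl⟩
      rw [mem_chains_iff (by omega)] at hq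
      refine ⟨?_, by simp, fun j => ?_⟩
      · have := Fin.snoc_castSucc (α := fun _ => Fin N → ℕ) (extendZero N l) q 0
        rw [Fin.castSucc_zero] at this
        rw [this, hq.1]
      · induction j using Fin.lastCases with
        | last =>
          rw [Fin.succ_last, Fin.snoc_last, Fin.snoc_castSucc, hq.2.1]
          exact (interlace_extendZero_iff hk l μ).2 hμ
        | cast j =>
          rw [Fin.succ_castSucc, Fin.snoc_castSucc, Fin.snoc_castSucc]
          exact hq.2.2 j
    · rintro ⟨h0, hlast, hint⟩
      have hz := apply_eq_zero_of_interlace h0 hint (Fin.last k).castSucc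
      set μ : Fin k → ℕ := fun i => p (Fin.last k).castSucc (Fin.castLE (by omega) i) with hμ
      have hext : p (Fin.last k).castSucc = extendZero N μ := by
        ext i
        by_cases hik : (i : ℕ) < k
        · simp [extendZero, hik, hμ, Fin.castLE]
        · simp [extendZero, hik, hz i (by simpa using hik)]
      refine ⟨μ, ?_, Fin.init p, ?_, ?_⟩
      · rw [← interlace_extendZero_iff hk, ← hext, ← hlast, ← Fin.succ_last]
        exact hint _
      · rw [mem_chains_iff (by omega)]
        refine ⟨h0, hext, fun j => ?_⟩
        simpa [Fin.init] using hint j.castSucc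
      · rw [← hlast, Fin.snoc_init_self]

/-- The weight of an interlacing sequence. -/
def chainWeight {N k : ℕ} (x : Fin k → ℂ) (p : Fin (k + 1) → Fin N → ℕ) : ℂ :=
  ∏ j : Fin k, x j ^ (wt (p j.succ) - wt (p j.castSucc))

lemma antitone_of_mem_below {k : ℕ} {l : Fin (k + 1) → ℕ} {μ : Fin k → ℕ} (hμ : μ ∈ below l) :
    Antitone μ := by
  simp only [below, Fintype.mem_piFinset, Finset.mem_Icc] at hμ
  obtain _ | k := k
  · exact fun i => i.elim0
  · refine Fin.antitone_iff_succ_le.2 fun i => ?_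
    calc μ i.succ ≤ l i.succ.castSucc := (hμ _).2
      _ = l i.castSucc.succ := by rw [Fin.succ_castSucc]
      _ ≤ μ i.castSucc := (hμ _).1

/-- The combinatorial Schur polynomial times the Vandermonde product is the alternant. -/
lemma sum_chainWeight_mul_vprod {N : ℕ} : ∀ {k : ℕ} (_ : k ≤ N) (x : Fin k → ℂ) (l : Fin k → ℕ)
    (_ : Antitone l), (∑ p ∈ chains N k l, chainWeight x p) * vprod x = alternant x l
  | 0, _, x, l, _ => by simp [chains, chainWeight, vprod, alternant]
  | k + 1, hk, x, l, hl => by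
    have hdisj : ((below l : Finset (Fin k → ℕ)) : Set (Fin k → ℕ)).PairwiseDisjoint fun μ =>
        (chains N k μ).image fun p =>
          (Fin.snoc p (extendZero N l) : Fin (k + 2) → Fin N → ℕ) := by
      intro μ _ ν _ hne
      rw [Function.onFun, Finset.disjoint_left]
      intro q hq hq'
      simp only [Finset.mem_image] at hq hq'
      obtain ⟨p, hp, rfl⟩ := hq
      obtain ⟨p', hp', he⟩ := hq'
      have := (Fin.snoc_inj.1 he).1
      subst this
      rw [mem_chains_iff (by omega)] at hp hp'
      exact hne (extendZero_injective (by omega) (hp.2.1.symm.trans hp'.2.1))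
    rw [alternant_succ x l hl, vprod_succ, chains, Finset.sum_biUnion hdisj, ← mul_assoc,
      mul_comm, Finset.sum_mul]
    congr 1
    refine Finset.sum_congr rfl fun μ hμ => ?_
    rw [Finset.sum_image fun p _ q _ h => (Fin.snoc_inj.1 h).1,
      ← sum_chainWeight_mul_vprod (show k ≤ N by omega) _ μ (antitone_of_mem_below hμ),
      ← mul_assoc, Finset.mul_sum]
    congr 1
    refine Finset.sum_congr rfl fun p hp => ?_
    rw [mem_chains_iff (by omega)] at hp
    rw [chainWeight, Fin.prod_univ_castSucc, mul_comm, Fin.succ_last, Fin.snoc_last,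
      Fin.snoc_castSucc, hp.2.1, wt_extendZero hk, wt_extendZero (by omega)]
    congr 1
    refine Finset.prod_congr rfl fun j _ => ?_
    rw [Fin.succ_castSucc, Fin.snoc_castSucc, Fin.snoc_castSucc]

/-- Products of nonnegative summable families, one for each coordinate, are summable. -/
lemma summable_pi_prod_of_nonneg {ι : Type*} [Fintype ι] {f : ι → ℕ → ℝ}
    (h0 : ∀ i m, 0 ≤ f i m) (hf : ∀ i, Summable (f i)) :
    Summable fun k : ι → ℕ => ∏ i, f i (k i) := by
  classical
  refine summable_of_sum_le (c := ∏ i, ∑' m, f i m)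
    (fun k => Finset.prod_nonneg fun i _ => h0 i _) fun s => ?_
  calc ∑ k ∈ s, ∏ i, f i (k i)
      ≤ ∑ k ∈ Fintype.piFinset fun i => s.image fun k => k i, ∏ i, f i (k i) := by
        refine Finset.sum_le_sum_of_subset_of_nonneg (fun k hk => ?_)
          fun k _ _ => Finset.prod_nonneg fun i _ => h0 i _
        exact Fintype.mem_piFinset.2 fun i => Finset.mem_image_of_mem (fun k => k i) hk
    _ = ∏ i, ∑ m ∈ s.image fun k => k i, f i m := (Finset.prod_univ_sum _ _).symm
    _ ≤ ∏ i, ∑' m, f i m := Finset.prod_le_prod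
        (fun i _ => Finset.sum_nonneg fun m _ => h0 i m)
        fun i _ => (hf i).sum_le_tsum _ fun m _ => h0 i m

/-- A finite product of absolutely convergent series. -/
lemma hasSum_pi_prod {ι : Type*} [Fintype ι] {f : ι → ℕ → ℂ} {s : ι → ℂ}
    (hf : ∀ i, HasSum (f i) (s i)) :
    HasSum (fun k : ι → ℕ => ∏ i, f i (k i)) (∏ i, s i) := by
  classical
  have hs : Summable fun k : ι → ℕ => ∏ i, f i (k i) := by
    refine Summable.of_norm ?_
    simpa only [norm_prod] using
      summable_pi_prod_of_nonneg (fun i m => norm_nonneg (f i m)) fun i => (hf i).summable.norm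
  have hmono : Filter.Tendsto (fun N => Fintype.piFinset fun _ : ι => Finset.range N)
      Filter.atTop Filter.atTop := by
    refine Filter.tendsto_atTop_finset_of_monotone (fun a b hab => ?_) fun k => ?_
    · exact Fintype.piFinset_subset _ _ fun _ => Finset.range_mono hab
    · refine ⟨(∑ i, k i) + 1, Fintype.mem_piFinset.2 fun i => Finset.mem_range.2 ?_⟩
      exact Nat.lt_succ_of_le (Finset.single_le_sum (fun _ _ => Nat.zero_le _) (Finset.mem_univ i))
  have h1 := hs.hasSum.comp hmono
  have h2 : Filter.Tendsto (fun N => ∏ i, ∑ m ∈ Finset.range N, f i m) Filter.atTop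
      (nhds (∏ i, s i)) :=
    tendsto_finsetProd _ fun i _ => (hf i).tendsto_sum_nat
  have h3 := tendsto_nhds_unique (h1.congr fun N => (Finset.prod_univ_sum _ _).symm) h2
  exact h3 ▸ hs.hasSum

/-- A determinant of power series in `x i * y j`, expanded as a series over exponent vectors. -/
lemma hasSum_det_powerSeries {n : ℕ} (x y : Fin n → ℂ) (a : ℕ → ℂ) (g : Fin n → Fin n → ℂ)
    (hg : ∀ i j, HasSum (fun m => a m * (x i * y j) ^ m) (g i j)) :
    HasSum (fun k : Fin n → ℕ => (∏ j, a (k j)) * (∏ j, y j ^ k j) *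
      (Matrix.of fun i j => x i ^ k j).det) (Matrix.of g).det := by
  simp only [Matrix.det_apply', Matrix.of_apply, Finset.mul_sum]
  refine hasSum_sum fun σ _ => ((hasSum_pi_prod fun j => hg (σ j) j).mul_left
    ((Equiv.Perm.sign σ : ℤ) : ℂ)).congr_fun fun k => ?_
  simp only [mul_pow, Finset.prod_mul_distrib]
  ring

/-- The strictly decreasing sequence `λ + δ` attached to a partition `λ`. -/
def addStaircase {n : ℕ} (l : Fin n → ℕ) : Fin n → ℕ := fun j => l j + (n - 1 - (j : ℕ))

lemma addStaircase_strictAnti {n : ℕ} {l : Fin n → ℕ} (hl : Antitone l) :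
    StrictAnti (addStaircase l) := by
  intro i j hij
  have h1 := hl hij.le
  have h2 : (i : ℕ) < j := hij
  have h3 := j.2
  simp only [addStaircase]
  omega

lemma exists_addStaircase_eq {n : ℕ} {k : Fin n → ℕ} (hk : StrictAnti k) :
    ∃ l : Fin n → ℕ, Antitone l ∧ addStaircase l = k := by
  obtain _ | n := n
  · exact ⟨k, hk.antitone, Subsingleton.elim _ _⟩
  have hstep : ∀ i : Fin n, k i.succ + 1 ≤ k i.castSucc := fun i => hk Fin.castSucc_lt_succ
  have hle : ∀ j : Fin (n + 1), n - (j : ℕ) ≤ k j := by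
    intro j
    induction j using Fin.reverseInduction with
    | last => simp
    | cast j ih =>
      have := hstep j
      simp only [Fin.val_succ, Fin.val_castSucc] at ih ⊢
      omega
  refine ⟨fun j => k j - (n - (j : ℕ)), Fin.antitone_iff_succ_le.2 fun i => ?_, ?_⟩
  · have h1 := hstep i
    have h2 := i.2
    simp only [Fin.val_succ, Fin.val_castSucc]
    omega
  · ext j
    have := hle j
    simp only [addStaircase, add_tsub_cancel_right]
    omega

/-- Rearrangements of the sequences `λ + δ`, over all partitions `λ`. -/
def rearrange {n : ℕ} (q : {l : Fin n → ℕ // Antitone l} × Equiv.Perm (Fin n)) : Fin n → ℕ :=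
  addStaircase q.1.1 ∘ q.2

lemma rearrange_injective {n : ℕ} : Function.Injective (rearrange (n := n)) := by
  rintro ⟨⟨l, hl⟩, σ⟩ ⟨⟨l', hl'⟩, σ'⟩ h
  simp only [rearrange] at h
  have h1 : addStaircase l = addStaircase l' := by
    rw [← (addStaircase_strictAnti hl).range_inj (addStaircase_strictAnti hl'),
      ← σ.surjective.range_comp (addStaircase l), h, σ'.surjective.range_comp]
  have h2 : l = l' := by
    ext j
    simpa [addStaircase] using congrFun h1 j
  subst h2
  have h3 : σ = σ' := Equiv.ext fun j =>
    (addStaircase_strictAnti hl).injective (congrFun h j)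
  rw [h3]

lemma mem_range_rearrange {n : ℕ} {k : Fin n → ℕ} (hk : Function.Injective k) :
    k ∈ Set.range (rearrange (n := n)) := by
  have hanti : StrictAnti (k ∘ (Fin.revPerm.trans (Tuple.sort k))) := by
    have hm : StrictMono (k ∘ Tuple.sort k) :=
      (Tuple.monotone_sort k).strictMono_of_injective (hk.comp (Tuple.sort k).injective)
    exact fun i j hij => hm (Fin.rev_lt_rev.2 hij)
  obtain ⟨l, hl, he⟩ := exists_addStaircase_eq hanti
  refine ⟨(⟨l, hl⟩, (Fin.revPerm.trans (Tuple.sort k)).symm), ?_⟩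
  simp only [rearrange, he]
  ext j
  simp

lemma sum_perm_rearrange {n : ℕ} (x y : Fin n → ℂ) (a : ℕ → ℂ)
    (l : {l : Fin n → ℕ // Antitone l}) :
    ∑ σ : Equiv.Perm (Fin n), (∏ j, a (rearrange (l, σ) j)) * (∏ j, y j ^ rearrange (l, σ) j) *
      (Matrix.of fun i j => x i ^ rearrange (l, σ) j).det =
    (∏ j, a (addStaircase l.1 j)) * (alternant x l.1 * alternant y l.1) := by
  have hx : ∀ σ : Equiv.Perm (Fin n), (Matrix.of fun i j => x i ^ rearrange (l, σ) j).det =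
      ((Equiv.Perm.sign σ : ℤ) : ℂ) * alternant x l.1 := fun σ =>
    Matrix.det_permute' σ (Matrix.of fun i j : Fin n => x i ^ addStaircase l.1 j)
  have ha : ∀ σ : Equiv.Perm (Fin n),
      ∏ j, a (rearrange (l, σ) j) = ∏ j, a (addStaircase l.1 j) := fun σ =>
    Equiv.prod_comp σ fun j => a (addStaircase l.1 j)
  have hy : alternant y l.1 = ∑ σ : Equiv.Perm (Fin n), ((Equiv.Perm.sign σ : ℤ) : ℂ) *
      ∏ j, y j ^ rearrange (l, σ) j := by
    rw [alternant, ← Matrix.det_transpose, Matrix.det_apply']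
    rfl
  simp only [hx, ha]
  rw [hy, Finset.mul_sum, Finset.mul_sum]
  exact Finset.sum_congr rfl fun σ _ => by ring

/-- The Cauchy–Binet formula for power series. -/
lemma hasSum_alternant_mul_alternant {n : ℕ} (x y : Fin n → ℂ) (a : ℕ → ℂ)
    (g : Fin n → Fin n → ℂ) (hg : ∀ i j, HasSum (fun m => a m * (x i * y j) ^ m) (g i j)) :
    HasSum (fun l : {l : Fin n → ℕ // Antitone l} =>
      (∏ j, a (addStaircase l.1 j)) * (alternant x l.1 * alternant y l.1)) (Matrix.of g).det := by
  have h := hasSum_det_powerSeries x y a g hg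
  rw [← rearrange_injective.hasSum_iff] at h
  · convert h.prod_fiberwise fun l => hasSum_fintype _ using 2 with l
    exact (sum_perm_rearrange x y a l).symm
  · intro k hk
    have hninj : ¬ Function.Injective k := fun hinj => hk (mem_range_rearrange hinj)
    simp only [Function.Injective, not_forall] at hninj
    obtain ⟨i, j, hij, hne⟩ := hninj
    rw [Matrix.det_zero_of_column_eq hne fun m => by simp [hij], mul_zero]

lemma hasSum_one_sub_pow_mul_pow {t z : ℂ} (ht : ‖t‖ < 1) (hz : ‖z‖ < 1) :
    HasSum (fun m : ℕ => (1 - t ^ (m + 1)) * z ^ m) ((1 - t) / ((1 - z) * (1 - t * z))) := by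
  have htz : ‖t * z‖ < 1 := by
    rw [norm_mul]
    exact mul_lt_one_of_nonneg_of_lt_one_left (norm_nonneg _) ht hz.le
  have hne : ∀ {w : ℂ}, ‖w‖ < 1 → 1 - w ≠ 0 := fun {w} hw h => by
    rw [← sub_eq_zero.1 h, norm_one] at hw
    exact lt_irrefl _ hw
  have hval : (1 - t) / ((1 - z) * (1 - t * z)) = (1 - z)⁻¹ - t * (1 - t * z)⁻¹ := by
    have h1 := hne hz
    have h2 := hne htz
    rw [← div_eq_mul_inv, ← one_div, div_sub_div _ _ h1 h2]
    congr 1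
    ring
  rw [hval]
  exact ((hasSum_geometric_of_norm_lt_one hz).sub
    ((hasSum_geometric_of_norm_lt_one htz).mul_left t)).congr_fun fun m => by ring

lemma vprod_ne_zero {n : ℕ} {x : Fin n → ℂ} (hx : Function.Injective x) : vprod x ≠ 0 :=
  Finset.prod_ne_zero_iff.2 fun _ _ => Finset.prod_ne_zero_iff.2 fun _ hj =>
    sub_ne_zero.2 fun h => (Finset.mem_Ioi.1 hj).ne (hx h)

lemma sum_tsub_of_le_succ {n : ℕ} (w : Fin (n + 1) → ℕ)
    (hw : ∀ j : Fin n, w j.castSucc ≤ w j.succ) :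
    ∑ j : Fin n, (w j.succ - w j.castSucc) = w (Fin.last n) - w 0 := by
  rw [Finset.sum_tsub_distrib _ fun j _ => hw j]
  have h1 := Fin.sum_univ_succ w
  have h2 := Fin.sum_univ_castSucc w
  omega

lemma wt_le_of_interlace {m : ℕ} {a b : Fin m → ℕ} (h : Interlace a b) : wt b ≤ wt a :=
  Finset.sum_le_sum fun i _ => h.1 i

lemma antitone_of_interlace {m : ℕ} {a b : Fin m → ℕ} (h : Interlace a b) : Antitone a := by
  obtain _ | m := m
  · exact fun i => i.elim0
  · exact Fin.antitone_iff_succ_le.2 fun i =>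
      (h.2 i (by simp)).trans (h.1 i.castSucc)

/-- If `∅ = p 0 ≺ p 1 ≺ ⋯ ≺ p n`, every `x j` has norm at most `ρ ^ (n + 1)`, and `ρ ≤ 1`, then
the weight of `p` is dominated by a product over all entries of `p`. -/
lemma norm_chainWeight_le {n m : ℕ} {x : Fin n → ℂ} {ρ : ℝ} (h0 : 0 ≤ ρ) (h1 : ρ ≤ 1)
    (hx : ∀ j, ‖x j‖ ≤ ρ ^ (n + 1)) {p : Fin (n + 1) → Fin m → ℕ} (hp0 : p 0 = fun _ => 0)
    (hp : ∀ j : Fin n, Interlace (p j.succ) (p j.castSucc)) :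
    ‖chainWeight x p‖ ≤ ∏ q : Fin (n + 1) × Fin m, ρ ^ p q.1 q.2 := by
  have hstep : ∀ j : Fin n, wt (p j.castSucc) ≤ wt (p j.succ) := fun j =>
    wt_le_of_interlace (hp j)
  have hmono : Monotone fun j => wt (p j) := Fin.monotone_iff_le_succ.2 hstep
  have hsum : ∑ q : Fin (n + 1) × Fin m, p q.1 q.2 ≤ (n + 1) * wt (p (Fin.last n)) := by
    rw [Fintype.sum_prod_type]
    calc ∑ j, wt (p j) ≤ ∑ _j : Fin (n + 1), wt (p (Fin.last n)) :=
          Finset.sum_le_sum fun j _ => hmono (Fin.le_last j)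
      _ = _ := by simp
  rw [Finset.prod_pow_eq_pow_sum]
  calc ‖chainWeight x p‖
      = ∏ j : Fin n, ‖x j‖ ^ (wt (p j.succ) - wt (p j.castSucc)) := by
        simp [chainWeight, norm_prod]
    _ ≤ ∏ j : Fin n, (ρ ^ (n + 1)) ^ (wt (p j.succ) - wt (p j.castSucc)) :=
        Finset.prod_le_prod (fun j _ => by positivity)
          fun j _ => pow_le_pow_left₀ (norm_nonneg _) (hx j) _
    _ = ρ ^ ((n + 1) * wt (p (Fin.last n))) := by
        rw [Finset.prod_pow_eq_pow_sum, sum_tsub_of_le_succ (fun j => wt (p j)) hstep, pow_mul]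
        simp [hp0, wt]
    _ ≤ _ := pow_le_pow_of_le_one h0 h1 hsum

lemma norm_prod_one_sub_pow_le {n : ℕ} {t : ℂ} (ht : ‖t‖ < 1) (e : Fin n → ℕ) :
    ‖∏ i, (1 - t ^ e i)‖ ≤ 2 ^ n := by
  rw [norm_prod]
  calc ∏ i, ‖1 - t ^ e i‖ ≤ ∏ _i : Fin n, (2 : ℝ) := by
        refine Finset.prod_le_prod (fun _ _ => norm_nonneg _) fun i _ => ?_
        have h := norm_sub_le (1 : ℂ) (t ^ e i)
        have h' : ‖t ^ e i‖ ≤ 1 := by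
          rw [norm_pow]
          exact pow_le_one₀ (norm_nonneg _) ht.le
        rw [norm_one] at h
        linarith
    _ = 2 ^ n := by simp

/-- Pairs of interlacing sequences with a common end, i.e. diagonal slices of plane partitions. -/
abbrev DiagonalSlices (n : ℕ) : Type :=
  {p : (Fin (n + 1) → Fin n → ℕ) × (Fin (n + 1) → Fin n → ℕ) //
    (∀ k, Antitone (p.1 k)) ∧ (∀ k, Antitone (p.2 k)) ∧
    p.1 0 = (fun _ => 0) ∧ p.2 0 = (fun _ => 0) ∧
    p.1 (Fin.last n) = p.2 (Fin.last n) ∧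
    (∀ k : Fin n, Interlace (p.1 k.succ) (p.1 k.castSucc)) ∧
    (∀ k : Fin n, Interlace (p.2 k.succ) (p.2 k.castSucc))}

lemma summable_diagonalSlices {n : ℕ} {x y : Fin n → ℂ} {t : ℂ} {r : ℝ} (hr0 : 0 ≤ r)
    (hr1 : r < 1) (hx : ∀ i, ‖x i‖ ≤ r) (hy : ∀ i, ‖y i‖ ≤ r) (ht : ‖t‖ < 1) :
    Summable fun p : DiagonalSlices n =>
      (∏ i : Fin n, (1 - t ^ (p.1.1 (Fin.last n) i + (n - (i : ℕ))))) *
        chainWeight x p.1.1 * chainWeight y p.1.2 := by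
  obtain ⟨ρ, h0, h1, hρ⟩ : ∃ ρ : ℝ, 0 ≤ ρ ∧ ρ < 1 ∧ ρ ^ (n + 1) = r :=
    ⟨r ^ (((n + 1 : ℕ) : ℝ)⁻¹), by positivity, Real.rpow_lt_one hr0 hr1 (by positivity),
      Real.rpow_inv_natCast_pow hr0 (Nat.succ_ne_zero n)⟩
  let ι := (Fin (n + 1) × Fin n) ⊕ (Fin (n + 1) × Fin n)
  let entries : DiagonalSlices n → ι → ℕ := fun p =>
    Sum.elim (fun q => p.1.1 q.1 q.2) (fun q => p.1.2 q.1 q.2)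
  have hinj : Function.Injective entries := by
    intro p p' h
    refine Subtype.ext (Prod.ext ?_ ?_)
    · ext j i
      exact congrFun h (Sum.inl (j, i))
    · ext j i
      exact congrFun h (Sum.inr (j, i))
  have hsum : Summable fun k : ι → ℕ => ∏ q, ρ ^ k q :=
    summable_pi_prod_of_nonneg (fun _ m => pow_nonneg h0 m)
      fun _ => summable_geometric_of_lt_one h0 h1
  refine Summable.of_norm_bounded ((hsum.comp_injective hinj).mul_left (2 ^ n)) fun p => ?_
  obtain ⟨-, -, hp1, hp2, -, hi1, hi2⟩ := p.2
  rw [norm_mul, norm_mul, mul_assoc]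
  simp only [Function.comp_apply, ι, entries, Fintype.prod_sum_type, Sum.elim_inl, Sum.elim_inr]
  subst hρ
  gcongr
  · exact norm_prod_one_sub_pow_le ht _
  · exact norm_chainWeight_le h0 h1.le hx hp1 hi1
  · exact norm_chainWeight_le h0 h1.le hy hp2 hi2

/-- Diagonal slices grouped by the main diagonal. -/
def diagonalSlicesEquiv (n : ℕ) :
    (Σ l : {l : Fin n → ℕ // Antitone l}, ↥(chains n n l.1) × ↥(chains n n l.1)) ≃
      DiagonalSlices n where
  toFun c := ⟨(c.2.1.1, c.2.2.1), by
    have h1 := (mem_chains_iff le_rfl _ _).1 c.2.1.2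
    have h2 := (mem_chains_iff le_rfl _ _).1 c.2.2.2
    refine ⟨fun k => ?_, fun k => ?_, h1.1, h2.1, h1.2.1.trans h2.2.1.symm, h1.2.2, h2.2.2⟩
    · induction k using Fin.cases with
      | zero =>
        simp only [h1.1]
        exact antitone_const
      | succ k => exact antitone_of_interlace (h1.2.2 k)
    · induction k using Fin.cases with
      | zero =>
        simp only [h2.1]
        exact antitone_const
      | succ k => exact antitone_of_interlace (h2.2.2 k)⟩
  invFun p := ⟨⟨p.1.1 (Fin.last n), p.2.1 _⟩,
    ⟨p.1.1, (mem_chains_iff le_rfl _ _).2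
      ⟨p.2.2.2.1, (extendZero_self _).symm, p.2.2.2.2.2.2.1⟩⟩,
    ⟨p.1.2, (mem_chains_iff le_rfl _ _).2
      ⟨p.2.2.2.2.1, p.2.2.2.2.2.1.symm.trans (extendZero_self _).symm, p.2.2.2.2.2.2.2⟩⟩⟩
  left_inv := by
    rintro ⟨⟨l, hl⟩, ⟨c, hc⟩, ⟨d, hd⟩⟩
    have h1 := ((mem_chains_iff le_rfl _ _).1 hc).2.1
    rw [extendZero_self] at h1
    dsimp only at h1 ⊢
    subst h1
    rfl
  right_inv _ := rfl

lemma sum_chains_eq {n : ℕ} {x y : Fin n → ℂ} (hx : Function.Injective x)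
    (hy : Function.Injective y) (t : ℂ) (l : {l : Fin n → ℕ // Antitone l}) :
    ∑ c : ↥(chains n n l.1) × ↥(chains n n l.1),
      (∏ i : Fin n, (1 - t ^ (c.1.1 (Fin.last n) i + (n - (i : ℕ))))) *
        chainWeight x c.1.1 * chainWeight y c.2.1 =
    (vprod x * vprod y)⁻¹ * ((∏ j, (1 - t ^ (addStaircase l.1 j + 1))) *
      (alternant x l.1 * alternant y l.1)) := by
  have htop : ∀ c : ↥(chains n n l.1),
      ∏ i : Fin n, (1 - t ^ (c.1 (Fin.last n) i + (n - (i : ℕ)))) =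
        ∏ j, (1 - t ^ (addStaircase l.1 j + 1)) := by
    intro c
    rw [((mem_chains_iff le_rfl _ _).1 c.2).2.1, extendZero_self]
    refine Finset.prod_congr rfl fun i _ => ?_
    have := i.2
    simp only [addStaircase]
    congr 2
    omega
  simp only [htop]
  rw [← sum_chainWeight_mul_vprod le_rfl x l.1 l.2, ← sum_chainWeight_mul_vprod le_rfl y l.1 l.2,
    Fintype.sum_prod_type]
  simp only [mul_assoc, ← Finset.mul_sum]
  rw [← Finset.sum_mul, Finset.sum_coe_sort (chains n n l.1) (chainWeight x),
    Finset.sum_coe_sort (chains n n l.1) (chainWeight y)]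
  have h1 := vprod_ne_zero hx
  have h2 := vprod_ne_zero hy
  field_simp

/-- **Refined generating series of plane partitions** (equation (10) of the paper):
summing over all plane partitions with base in an `n × n` square, recorded as interlacing
sequences `∅ = λ⁽⁰⁾ ≺ λ⁽¹⁾ ≺ ⋯ ≺ λ⁽ⁿ⁾ = μ⁽ⁿ⁾ ≻ ⋯ ≻ μ⁽¹⁾ ≻ μ⁽⁰⁾ = ∅`,
`Σ ∏_{i=1}^n (1-t^{λ⁽ⁿ⁾ᵢ-i+n+1}) ∏ᵢ xᵢ^{|λ⁽ⁱ⁾|-|λ⁽ⁱ⁻¹⁾|} yᵢ^{|μ⁽ⁱ⁾|-|μ⁽ⁱ⁻¹⁾|}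
  = (Δ(x)ₙΔ(y)ₙ)⁻¹ det[(1-t)/((1-xᵢyⱼ)(1-t xᵢyⱼ))]`.
It is stated here for complex values of the variables in a domain of convergence. -/
theorem refined_plane_partition_series (n : ℕ) (hn : 1 ≤ n) (x y : Fin n → ℂ) (t : ℂ)
    (hx : ∀ i, ‖x i‖ < 1 / (8 * n)) (hy : ∀ j, ‖y j‖ < 1 / (8 * n)) (ht : ‖t‖ < 1)
    (hxinj : Function.Injective x) (hyinj : Function.Injective y) :
    HasSum
      (fun p : {p : (Fin (n + 1) → Fin n → ℕ) × (Fin (n + 1) → Fin n → ℕ) //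
          (∀ k, Antitone (p.1 k)) ∧ (∀ k, Antitone (p.2 k)) ∧
          p.1 0 = (fun _ => 0) ∧ p.2 0 = (fun _ => 0) ∧
          p.1 (Fin.last n) = p.2 (Fin.last n) ∧
          (∀ k : Fin n, Interlace (p.1 k.succ) (p.1 k.castSucc)) ∧
          (∀ k : Fin n, Interlace (p.2 k.succ) (p.2 k.castSucc))} =>
        (∏ i : Fin n, (1 - t ^ (p.1.1 (Fin.last n) i + (n - (i : ℕ))))) *
          (∏ k : Fin n, x k ^ (wt (p.1.1 k.succ) - wt (p.1.1 k.castSucc))) *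
          ∏ k : Fin n, y k ^ (wt (p.1.2 k.succ) - wt (p.1.2 k.castSucc)))
      ((vprod x * vprod y)⁻¹ *
        (Matrix.of fun i j : Fin n =>
          (1 - t) / ((1 - x i * y j) * (1 - t * (x i * y j)))).det) := by
  have hn' : (1 : ℝ) ≤ n := by exact_mod_cast hn
  have hle : 1 / (8 * (n : ℝ)) ≤ 1 / 8 := by
    gcongr
    linarith
  have hx' : ∀ i, ‖x i‖ ≤ 1 / 8 := fun i => ((hx i).trans_le hle).le
  have hy' : ∀ i, ‖y i‖ ≤ 1 / 8 := fun i => ((hy i).trans_le hle).le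
  have hxy : ∀ i j, ‖x i * y j‖ < 1 := fun i j => by
    rw [norm_mul]
    nlinarith [hx' i, hy' j, norm_nonneg (x i), norm_nonneg (y j)]
  have hs := summable_diagonalSlices (by norm_num) (by norm_num) hx' hy' ht
  have hfiber := ((diagonalSlicesEquiv n).hasSum_iff.2 hs.hasSum).sigma fun l => hasSum_fintype _
  have hdet := (hasSum_alternant_mul_alternant x y (fun m => 1 - t ^ (m + 1)) _
    fun i j => hasSum_one_sub_pow_mul_pow ht (hxy i j)).mul_left (vprod x * vprod y)⁻¹
  have heq := hfiber.unique (hdet.congr_fun fun l => (sum_chains_eq hxinj hyinj t l))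
  exact heq ▸ hs.hasSum
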